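/- Let m be a positive integer, G any subgroup of GL_m(ℝ), Γ a polycyclic normal subgroup of G, and Δ any polycyclic subgroup of the quotient group G/Γ. Then there exists a subgroup H of G/Γ of countable index in G/Γ which intersects Δ trivially, i.e. H ∩ Δ = {1}. -/

import Mathlib

/-- A group is polycyclic if it admits a finite subnormal series with cyclic quotients. -/
def IsPolycyclic (G : Type*) [Group G] : Prop :=
  ∃ (d : ℕ) (s : Fin (d + 1) → Subgroup G),
    s 0 = ⊥ ∧ s (Fin.last d) = ⊤ ∧
    ∀ i : Fin d, s i.castSucc ≤ s i.succ ∧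
      ∃ hn : ((s i.castSucc).subgroupOf (s i.succ)).Normal,
        letI := hn
        IsCyclic (↥(s i.succ) ⧸ (s i.castSucc).subgroupOf (s i.succ))

section

open Cardinal Polynomial TopologicalSpace LaurentSeries WithZero
open scoped MatrixGroups
universe u

theorem Subfield.countable_closure {K : Type*} [Field K] {s : Set K} (hs : s.Countable) :
    Countable (Subfield.closure s) := by
  rw [← mk_le_aleph0_iff]
  exact (Subfield.cardinalMk_closure_le_max s).trans (max_le hs.le_aleph0 le_rfl)

theorem Polynomial.countable (R : Type*) [Semiring R] [Countable R] : Countable R[X] := by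
  rw [← mk_le_aleph0_iff]
  exact Polynomial.cardinalMk_le_max.trans (max_le mk_le_aleph0 le_rfl)

/-- An algebraically closed algebraic extension of a separable normed field is separable:
the roots of polynomials over a countable dense subfield are dense. -/
theorem separableSpace_of_isAlgebraic (K L : Type*) [NormedField K] [NormedField L]
    [NormedAlgebra K L] [Algebra.IsAlgebraic K L] [IsAlgClosed L] [SeparableSpace K] :
    SeparableSpace L := by
  obtain ⟨s, hs, hd⟩ := exists_countable_dense K
  let Q := Subfield.closure s
  have : Countable Q := Subfield.countable_closure hs
  have hQ : DenseRange (algebraMap Q K) :=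
    hd.mono fun x hx ↦ ⟨⟨x, Subfield.subset_closure hx⟩, rfl⟩
  have : Countable Q[X] := Polynomial.countable Q
  refine ⟨⋃ g : Q[X], {b | b ∈ (g.map (algebraMap Q K)).aroots L},
    Set.countable_iUnion fun g ↦ (Multiset.finite_toSet _).countable, ?_⟩
  rw [Metric.dense_iff]
  intro a r hr
  have hint : IsIntegral K a := Algebra.IsIntegral.isIntegral a
  set f := minpoly K a
  have hcont : Filter.Tendsto
      (fun ε : ℝ ↦ ((f.natDegree + 1) * ε) ^ (f.natDegree : ℝ)⁻¹ * max ‖a‖ 1)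
      (nhdsWithin 0 (Set.Ioi 0)) (nhds 0) := by
    have hdeg : 0 < (f.natDegree : ℝ)⁻¹ := by
      have := minpoly.natDegree_pos hint
      positivity
    have : Continuous
        (fun ε : ℝ ↦ ((f.natDegree + 1) * ε) ^ (f.natDegree : ℝ)⁻¹ * max ‖a‖ 1) :=
      ((continuous_const.mul continuous_id).rpow_const fun _ ↦ .inr hdeg.le).mul
        continuous_const
    have h0 := this.tendsto 0
    simp only [mul_zero, Real.zero_rpow hdeg.ne', zero_mul] at h0
    exact h0.mono_left nhdsWithin_le_nhds
  obtain ⟨ε, hεr, hε⟩ := ((hcont.eventually (gt_mem_nhds hr)).and self_mem_nhdsWithin).exists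
  obtain ⟨g, hgm, hgd, hgc⟩ :=
    exists_monic_and_natDegree_eq_and_norm_map_algebraMap_coeff_sub_lt hQ
      (minpoly.monic hint) hε
  obtain ⟨b, hb, hab⟩ := exists_aroots_norm_sub_lt_of_norm_coeff_sub_lt hε
    (minpoly.aeval K a) (minpoly.monic hint) (hgm.map _) (by simp [hgd]) hgc
    (IsAlgClosed.splits _)
  refine ⟨b, ?_, Set.mem_iUnion.2 ⟨g, hb⟩⟩
  rw [Metric.mem_ball, dist_comm, dist_eq_norm]
  exact hab.trans hεr

theorem LaurentSeries.separableSpace (F : Type*) [Field F] [Countable F] :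
    SeparableSpace F⸨X⸩ := by
  have : Countable F[X] := Polynomial.countable F
  have : Countable (RatFunc F) :=
    (IsLocalization.mk'_surjective (S := RatFunc F) (nonZeroDivisors F[X])).countable
  exact ⟨_, Set.countable_range _, LaurentSeries.coe_range_dense⟩

theorem LaurentSeries.continuum_le_cardinalMk (F : Type*) [Field F] : 𝔠 ≤ #F⸨X⸩ := by
  classical
  have hinj : Function.Injective fun s : Set ℕ ↦
      HahnSeries.ofPowerSeries ℤ F (PowerSeries.mk fun n ↦ if n ∈ s then 1 else 0) := by
    intro s t hst
    ext n
    have := congrArg (PowerSeries.coeff n) (HahnSeries.ofPowerSeries_injective hst)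
    by_cases hs : n ∈ s <;> by_cases ht : n ∈ t <;> simp_all
  simpa using lift_mk_le_lift_mk_of_injective hinj

/-- A field extension of a countable field embeds in every uncountable algebraically closed
extension of at least the same cardinality. -/
theorem nonempty_algHom_of_cardinalMk_le {F E L : Type u} [Field F] [Field E] [Field L]
    [Algebra F E] [Algebra F L] [IsAlgClosed L] [Countable F] (hL : ℵ₀ < #L) (h : #E ≤ #L) :
    Nonempty (E →ₐ[F] L) := by
  obtain ⟨s, hs⟩ := exists_isTranscendenceBasis F E
  obtain ⟨t, ht⟩ := exists_isTranscendenceBasis F L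
  have hst : #s ≤ #t := by
    rw [← IsAlgClosed.cardinal_eq_cardinal_transcendence_basis_of_aleph0_lt' _ ht mk_le_aleph0 hL]
    exact (mk_set_le s).trans h
  obtain ⟨e⟩ := hst
  let φ : Algebra.adjoin F (Set.range ((↑) : s → E)) →ₐ[F] L :=
    (MvPolynomial.aeval fun i ↦ (e i : L)).comp hs.1.aevalEquiv.symm.toAlgHom
  have hφ : Function.Injective φ :=
    (show Function.Injective (MvPolynomial.aeval fun i ↦ (e i : L)) from
      ht.1.comp e e.injective).comp hs.1.aevalEquiv.symm.injective
  let := φ.toRingHom.toAlgebra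
  have : IsScalarTower F (Algebra.adjoin F (Set.range ((↑) : s → E))) L :=
    .of_algebraMap_eq fun x ↦ (φ.commutes x).symm
  have : FaithfulSMul (Algebra.adjoin F (Set.range ((↑) : s → E))) L :=
    (faithfulSMul_iff_algebraMap_injective _ _).2 hφ
  have := hs.isAlgebraic
  exact ⟨(IsAlgClosed.lift (R := Algebra.adjoin F (Set.range ((↑) : s → E)))).restrictScalars F⟩

/-- The units `g` of `R` such that both `g` and `g⁻¹` are congruent to `1` modulo `I`. -/
def congruenceSubgroup {R : Type*} [Ring R] (I : NonUnitalSubring R) : Subgroup Rˣ where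
  carrier := {g | (g : R) - 1 ∈ I ∧ (↑g⁻¹ : R) - 1 ∈ I}
  one_mem' := by simp
  mul_mem' := by
    have key {a b : R} (ha : a - 1 ∈ I) (hb : b - 1 ∈ I) : a * b - 1 ∈ I := by
      have : a * b - 1 = (a - 1) * (b - 1) + (a - 1) + (b - 1) := by noncomm_ring
      exact this ▸ add_mem (add_mem (mul_mem ha hb) ha) hb
    rintro g h ⟨hg, hg'⟩ ⟨hh, hh'⟩
    exact ⟨by simpa using key hg hh, by simpa using key hh' hg'⟩
  inv_mem' := fun ⟨h, h'⟩ ↦ ⟨h', by simpa using h⟩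

theorem isOpen_congruenceSubgroup {R : Type*} [Ring R] [TopologicalSpace R] [IsTopologicalRing R]
    {I : NonUnitalSubring R} (hI : IsOpen (I : Set R)) :
    IsOpen (congruenceSubgroup I : Set Rˣ) :=
  (hI.preimage (Units.continuous_val.sub continuous_const)).inter
    (hI.preimage (Units.continuous_coe_inv.sub continuous_const))

theorem Subgroup.countable_quotient_of_isOpen {G : Type*} [Group G] [TopologicalSpace G]
    [SeparableSpace G] [SeparatelyContinuousMul G] {U : Subgroup G} (hU : IsOpen (U : Set G)) :
    Countable (G ⧸ U) := by
  have := QuotientGroup.discreteTopology hU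
  have : SeparableSpace (G ⧸ U) :=
    QuotientGroup.mk_surjective.denseRange.separableSpace QuotientGroup.continuous_mk
  exact separableSpace_iff_countable.1 this

instance Units.secondCountableTopology {M : Type*} [Monoid M] [TopologicalSpace M]
    [SecondCountableTopology M] : SecondCountableTopology Mˣ :=
  have : SecondCountableTopology Mᵐᵒᵖ := MulOpposite.opHomeomorph.symm.secondCountableTopology
  Units.isEmbedding_embedProduct.secondCountableTopology

theorem Subgroup.countable_quotient_comap {G G' : Type*} [Group G] [Group G'] (f : G →* G')
    (U : Subgroup G') [Countable (G' ⧸ U)] : Countable (G ⧸ U.comap f) := by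
  refine Function.Injective.countable (f := Quotient.map'
    (s₁ := QuotientGroup.leftRel (U.comap f)) (s₂ := QuotientGroup.leftRel U) f ?_) ?_
  · intro a b h
    simpa [QuotientGroup.leftRel_apply] using h
  · rintro ⟨a⟩ ⟨b⟩ h
    have := QuotientGroup.eq.1 h
    exact QuotientGroup.eq.2 (by simpa using this)

theorem Subgroup.countable_quotient_map {G G' : Type*} [Group G] [Group G'] {f : G →* G'}
    (hf : Function.Surjective f) (U : Subgroup G) [Countable (G ⧸ U)] :
    Countable (G' ⧸ U.map f) := by
  refine Function.Surjective.countable (f := Quotient.map'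
    (s₁ := QuotientGroup.leftRel U) (s₂ := QuotientGroup.leftRel (U.map f)) f ?_) ?_
  · intro a b h
    rw [QuotientGroup.leftRel_apply] at h ⊢
    simpa using Subgroup.mem_map_of_mem f h
  · exact Quotient.map_surjective _ hf

theorem LaurentSeries.nonempty_rankOne (F : Type*) [Field F] :
    Nonempty (Valued.v : Valuation F⸨X⸩ ℤᵐ⁰).RankOne := by
  have : (Valued.v : Valuation F⸨X⸩ ℤᵐ⁰).IsNontrivial :=
    ⟨_, by rw [LaurentSeries.valuation_X_pow F 1]; simp,
      by rw [LaurentSeries.valuation_X_pow F 1, ← exp_zero, ne_eq, exp_inj]; simp⟩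
  exact Valuation.nonempty_rankOne_iff_mulArchimedean.2
    (.comap MonoidWithZeroHom.ValueGroup₀.embedding.toMonoidHom
      MonoidWithZeroHom.ValueGroup₀.embedding_strictMono)

/-- A field of cardinality at most the continuum embeds in a separable ultrametric field whose norm
is trivial on a given countable subfield. -/
theorem exists_ringHom_separable_normedField {F E : Type u} [Field F] [Field E] [Algebra F E]
    [Countable F] (hE : #E ≤ 𝔠) :
    ∃ (L : Type u) (_ : NormedField L) (_ : IsUltrametricDist L) (_ : SeparableSpace L)
      (φ : E →+* L), ∀ a : F, ‖φ (algebraMap F E a)‖ < 1 → a = 0 := by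
  have := (LaurentSeries.nonempty_rankOne F).some
  let : NontriviallyNormedField F⸨X⸩ := Valued.toNontriviallyNormedField F⸨X⸩ ℤᵐ⁰
  have : IsUltrametricDist F⸨X⸩ :=
    inferInstanceAs (@IsUltrametricDist F⸨X⸩ (Valued.toNormedField F⸨X⸩ ℤᵐ⁰).toMetricSpace.toDist)
  have hF (a : F) (ha : ‖algebraMap F F⸨X⸩ a‖ < 1) : a = 0 := by
    by_contra h0
    have h1 : ‖algebraMap F F⸨X⸩ a⁻¹‖ ≤ 1 := Valued.toNormedField.norm_le_one_iff.2 <|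
      (LaurentSeries.val_le_one_iff_eq_coe F _).2 ⟨PowerSeries.C a⁻¹, by
        simp [LaurentSeries.algebraMap_apply]⟩
    rw [map_inv₀, norm_inv, inv_le_one₀ (norm_pos_iff.2 (by simpa using h0))] at h1
    exact h1.not_gt ha
  let L := AlgebraicClosure F⸨X⸩
  let : NontriviallyNormedField L := spectralNorm.nontriviallyNormedField F⸨X⸩ L
  let : NormedAlgebra F⸨X⸩ L := spectralNorm.normedAlgebra F⸨X⸩ L
  have : SeparableSpace F⸨X⸩ := LaurentSeries.separableSpace F
  have hL : 𝔠 ≤ #L := (LaurentSeries.continuum_le_cardinalMk F).trans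
    (mk_le_of_injective (algebraMap F⸨X⸩ L).injective)
  obtain ⟨φ⟩ := nonempty_algHom_of_cardinalMk_le (F := F) (aleph0_lt_continuum.trans_le hL)
    (hE.trans hL)
  refine ⟨L, inferInstance, IsUltrametricDist.of_normedAlgebra F⸨X⸩,
    separableSpace_of_isAlgebraic F⸨X⸩ L, φ, fun a ha ↦ hF a ?_⟩
  rw [← norm_algebraMap' L, ← IsScalarTower.algebraMap_apply]
  simpa using ha

/-- Over a field of cardinality at most the continuum, every countable set of invertible matrices
meets some subgroup of countable index in at most the identity. -/
theorem exists_countable_index_subgroup_disjoint {n E : Type u} [Fintype n] [DecidableEq n]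
    [Field E] (hE : #E ≤ 𝔠) (D : Set (GL n E)) (hD : D.Countable) :
    ∃ H : Subgroup (GL n E), Countable (GL n E ⧸ H) ∧ ∀ g ∈ D, g ∈ H → g = 1 := by
  let F := Subfield.closure (⋃ g ∈ D, Set.range fun p : n × n ↦ (g : Matrix n n E) p.1 p.2)
  have : Countable F :=
    Subfield.countable_closure (hD.biUnion fun g _ ↦ Set.countable_range _)
  obtain ⟨L, _, _, _, φ, hφ⟩ := exists_ringHom_separable_normedField (F := F) hE
  let I : NonUnitalSubring (Matrix n n L) :=
    { carrier := {A | ∀ i j, ‖A i j‖ < 1}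
      zero_mem' := by simp
      add_mem' := fun {A B} hA hB i j ↦
        (IsUltrametricDist.norm_add_le_max _ _).trans_lt (max_lt (hA i j) (hB i j))
      neg_mem' := fun {A} hA i j ↦ by simpa using hA i j
      mul_mem' := fun {A B} hA hB i j ↦ by
        rw [Matrix.mul_apply]
        refine Finset.sum_induction _ (‖·‖ < 1) (fun x y hx hy ↦
          (IsUltrametricDist.norm_add_le_max x y).trans_lt (max_lt hx hy)) (by simp) fun k _ ↦ ?_
        rw [norm_mul]
        exact mul_lt_one_of_nonneg_of_lt_one_left (norm_nonneg _) (hA i k) (hB k j).le }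
  have hI : IsOpen (I : Set (Matrix n n L)) := by
    have : (I : Set (Matrix n n L)) = ⋂ i, ⋂ j, {A | ‖A i j‖ < 1} := by
      ext A
      simp only [Set.mem_iInter]
      rfl
    rw [this]
    exact isOpen_iInter_of_finite fun i ↦ isOpen_iInter_of_finite fun j ↦
      isOpen_lt (continuous_id.matrix_elem i j).norm continuous_const
  have := UniformSpace.secondCountable_of_separable L
  have : SecondCountableTopology (Matrix n n L) :=
    inferInstanceAs (SecondCountableTopology (n → n → L))
  have := Subgroup.countable_quotient_of_isOpen (isOpen_congruenceSubgroup hI)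
  refine ⟨_, Subgroup.countable_quotient_comap (Matrix.GeneralLinearGroup.map φ)
    (congruenceSubgroup I), fun g hg hgI ↦ ?_⟩
  ext i j
  have hgF : (g : Matrix n n E) i j ∈ F :=
    Subfield.subset_closure (Set.mem_biUnion hg ⟨(i, j), rfl⟩)
  have h1 : (1 : Matrix n n E) i j ∈ F := by
    rw [Matrix.one_apply]; split_ifs <;> simp
  have hlt : ‖φ ((g : Matrix n n E) i j - (1 : Matrix n n E) i j)‖ < 1 := by
    simpa [Matrix.one_apply, apply_ite φ] using hgI.1 i j
  have := hφ (⟨_, hgF⟩ - ⟨_, h1⟩) hlt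
  exact congrArg Subtype.val (sub_eq_zero.1 this)

theorem IsPolycyclic.countable {G : Type*} [Group G] (h : IsPolycyclic G) : Countable G := by
  obtain ⟨d, s, h0, h1, hs⟩ := h
  have key : ∀ i, Countable (s i) := by
    intro i
    induction i using Fin.induction with
    | zero => rw [h0]; infer_instance
    | succ i ih =>
      obtain ⟨hle, hn, hc⟩ := hs i
      have : Countable ((s i.castSucc).subgroupOf (s i.succ)) :=
        (Subgroup.subgroupOfEquivOfLe hle).injective.countable
      have : Countable (s i.succ ⧸ (s i.castSucc).subgroupOf (s i.succ)) := by
        obtain ⟨g, hg⟩ := hc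
        exact Function.Surjective.countable hg
      exact (Subgroup.groupEquivQuotientProdSubgroup (s := (s i.castSucc).subgroupOf (s i.succ))
        ).injective.countable
  have := key (Fin.last d)
  rw [h1] at this
  exact Subgroup.topEquiv.symm.injective.countable

end

/-- If `G ≤ GL_m(ℝ)`, `Γ` is a polycyclic normal subgroup of `G`, and `Δ` is a polycyclic
subgroup of `G/Γ`, then there is a subgroup of countable index in `G/Γ` meeting `Δ`
trivially. -/
theorem exists_countable_index_subgroup_avoiding_polycyclic_in_quotient
    (m : ℕ) (hm : 0 < m) (G : Subgroup (Matrix.GeneralLinearGroup (Fin m) ℝ))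
    (Γ : Subgroup ↥G) [Γ.Normal] (hΓ : IsPolycyclic Γ)
    (Δ : Subgroup (↥G ⧸ Γ)) (hΔ : IsPolycyclic Δ) :
    ∃ H : Subgroup (↥G ⧸ Γ), Countable ((↥G ⧸ Γ) ⧸ H) ∧ H ⊓ Δ = ⊥ := by
  have := hΓ.countable
  have := hΔ.countable
  have : Countable (Δ.comap (QuotientGroup.mk' Γ)) :=
    (QuotientGroup.preimageMkEquivSubgroupProdSet Γ (Δ : Set (G ⧸ Γ))).injective.countable
  obtain ⟨H, _, hH⟩ := exists_countable_index_subgroup_disjoint Cardinal.mk_real.le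
    (G.subtype '' (Δ.comap (QuotientGroup.mk' Γ)))
    ((Set.to_countable (Δ.comap (QuotientGroup.mk' Γ) : Set G)).image _)
  have := Subgroup.countable_quotient_comap G.subtype H
  refine ⟨_, Subgroup.countable_quotient_map (QuotientGroup.mk'_surjective Γ)
    (H.comap G.subtype), ?_⟩
  rw [eq_bot_iff]
  rintro _ ⟨⟨g, hg, rfl⟩, hgΔ⟩
  have : g = 1 := Subtype.ext (hH g ⟨g, hgΔ, rfl⟩ hg)
  simp [this]
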